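/- arXiv:2011.08475 — 2 statements merged into one kernel-verified Lean document; each statement's English description precedes it below -/
import Mathlib

section
/- Let α₁ > 0, let γ* = ((2+α₁) − √((2+α₁)² − 4))/2 (which lies in (0,1)), and let g*(y) = ((1−γ*)/α₁)·exp(−(1−γ*)y/α₁). Then for every γ ∈ (0,1) and every probability density function g on (0,∞) with finite differential entropy satisfying (1−γ)·∫₀^∞ y·g(y) dy = α₁, the semi-continuous entropy satisfies −γ log γ − (1−γ) log(1−γ) + (1−γ)H(g) ≤ −γ* log γ* − (1−γ*) log(1−γ*) + (1−γ*)H(g*), where H(g) = −∫₀^∞ g(y) log g(y) dy. That is, the pair (γ*, g*) maximizes the entropy of semi-continuous distributions subject to the first-moment constraint E(Y) = α₁. -/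
open MeasureTheory

/-- Differential entropy of a density on `(0,∞)`. -/
noncomputable def dEnt (g : ℝ → ℝ) : ℝ :=
  -∫ y in Set.Ioi (0 : ℝ), g y * Real.log (g y)

/-- The point mass at zero of the maximum-entropy semi-continuous exponential
distribution. -/
noncomputable def gammaStar (α₁ : ℝ) : ℝ :=
  ((2 + α₁) - Real.sqrt ((2 + α₁) ^ 2 - 4)) / 2

/-- The continuous component of the maximum-entropy semi-continuous exponential
distribution. -/
noncomputable def gStar (α₁ : ℝ) (y : ℝ) : ℝ :=
  ((1 - gammaStar α₁) / α₁) * Real.exp (-(1 - gammaStar α₁) * y / α₁)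

theorem gammaStar_mem_Ioo {α₁ : ℝ} (hα : 0 < α₁) : gammaStar α₁ ∈ Set.Ioo (0 : ℝ) 1 := by
  have hs : Real.sqrt ((2 + α₁) ^ 2 - 4) < 2 + α₁ := by
    rw [Real.sqrt_lt' (by linarith)]
    linarith
  have hs' : α₁ < Real.sqrt ((2 + α₁) ^ 2 - 4) := by
    rw [Real.lt_sqrt hα.le]
    nlinarith
  unfold gammaStar
  constructor <;> linarith

theorem one_sub_gammaStar_sq {α₁ : ℝ} (hα : 0 < α₁) :
    (1 - gammaStar α₁) ^ 2 = α₁ * gammaStar α₁ := by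
  have hs : Real.sqrt ((2 + α₁) ^ 2 - 4) ^ 2 = (2 + α₁) ^ 2 - 4 :=
    Real.sq_sqrt (by nlinarith)
  unfold gammaStar
  linear_combination hs / 4

/-- The pointwise form of Gibbs' inequality. -/
theorem mul_log_add_sub_le_mul_log {t s : ℝ} (ht : 0 ≤ t) (hs : 0 < s) :
    t * Real.log s + (t - s) ≤ t * Real.log t := by
  rcases ht.eq_or_lt with rfl | ht
  · simp [hs.le]
  · have h := mul_le_mul_of_nonneg_left (Real.log_le_sub_one_of_pos (div_pos hs ht)) ht.le
    rw [Real.log_div hs.ne' ht.ne', mul_sub, mul_sub, mul_div_cancel₀ _ ht.ne'] at h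
    linarith

theorem integrableOn_exp_density {r : ℝ} (hr : 0 < r) :
    IntegrableOn (fun y => r * Real.exp (-r * y)) (Set.Ioi (0 : ℝ)) :=
  (integrableOn_exp_mul_Ioi (neg_lt_zero.2 hr) 0).const_mul r

theorem integral_exp_density {r : ℝ} (hr : 0 < r) :
    ∫ y in Set.Ioi (0 : ℝ), r * Real.exp (-r * y) = 1 := by
  rw [integral_const_mul, integral_exp_mul_Ioi (neg_lt_zero.2 hr) 0]
  field_simp
  simp

theorem integrableOn_id_mul_exp_density {r : ℝ} (hr : 0 < r) :
    IntegrableOn (fun y => y * (r * Real.exp (-r * y))) (Set.Ioi (0 : ℝ)) := by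
  have h := (integrableOn_rpow_mul_exp_neg_mul_rpow (s := 1) (p := 1) (by norm_num)
    one_pos hr).const_mul r
  simp only [Real.rpow_one] at h
  simpa only [IntegrableOn, mul_left_comm] using h

theorem integral_id_mul_exp_density {r : ℝ} (hr : 0 < r) :
    ∫ y in Set.Ioi (0 : ℝ), y * (r * Real.exp (-r * y)) = 1 / r := by
  have h := Real.integral_rpow_mul_exp_neg_mul_Ioi (a := 2) (by norm_num) hr
  have h' : ∀ y : ℝ, y * (r * Real.exp (-r * y)) =
      r * (y ^ ((2 : ℝ) - 1) * Real.exp (-(r * y))) := by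
    intro y
    norm_num
    ring
  simp_rw [h']
  rw [integral_const_mul, h, Real.Gamma_two, Real.rpow_two]
  field_simp

/-- The exponential density of rate `r` has differential entropy `1 - log r`. -/
theorem dEnt_exp_density {r : ℝ} (hr : 0 < r) :
    dEnt (fun y => r * Real.exp (-r * y)) = 1 - Real.log r := by
  have h : ∀ y : ℝ, r * Real.exp (-r * y) * Real.log (r * Real.exp (-r * y)) =
      Real.log r * (r * Real.exp (-r * y)) - r * (y * (r * Real.exp (-r * y))) := by
    intro y
    rw [Real.log_mul hr.ne' (Real.exp_pos _).ne', Real.log_exp]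
    ring
  unfold dEnt
  simp_rw [h]
  rw [integral_sub ((integrableOn_exp_density hr).const_mul _)
    ((integrableOn_id_mul_exp_density hr).const_mul _), integral_const_mul (Real.log r),
    integral_exp_density hr, integral_const_mul r, integral_id_mul_exp_density hr]
  field_simp
  ring

/-- Gibbs' inequality against the exponential density of rate `r`. -/
theorem dEnt_le_mul_integral_sub_log {r : ℝ} (hr : 0 < r) {g : ℝ → ℝ}
    (hg0 : ∀ y ∈ Set.Ioi (0 : ℝ), 0 ≤ g y) (hg : IntegrableOn g (Set.Ioi (0 : ℝ)))
    (hg1 : (∫ y in Set.Ioi (0 : ℝ), g y) = 1)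
    (hglog : IntegrableOn (fun y => g y * Real.log (g y)) (Set.Ioi (0 : ℝ)))
    (hgy : IntegrableOn (fun y => y * g y) (Set.Ioi (0 : ℝ))) :
    dEnt g ≤ r * (∫ y in Set.Ioi (0 : ℝ), y * g y) - Real.log r := by
  have hle : ∀ y ∈ Set.Ioi (0 : ℝ),
      ((Real.log r + 1) * g y - r * (y * g y)) - r * Real.exp (-r * y)
        ≤ g y * Real.log (g y) := by
    intro y hy
    have h := mul_log_add_sub_le_mul_log (hg0 y hy) (mul_pos hr (Real.exp_pos (-r * y)))
    rw [Real.log_mul hr.ne' (Real.exp_pos _).ne', Real.log_exp] at h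
    linarith
  have hint₁ : IntegrableOn (fun y => (Real.log r + 1) * g y) (Set.Ioi (0 : ℝ)) :=
    hg.const_mul _
  have hint₂ : IntegrableOn (fun y => r * (y * g y)) (Set.Ioi (0 : ℝ)) := hgy.const_mul _
  have hint₃ : IntegrableOn (fun y => (Real.log r + 1) * g y - r * (y * g y))
      (Set.Ioi (0 : ℝ)) := hint₁.sub hint₂
  have h := setIntegral_mono_on (hint₃.sub (integrableOn_exp_density hr)) hglog
    measurableSet_Ioi hle
  rw [integral_sub' hint₃ (integrableOn_exp_density hr), integral_sub hint₁ hint₂,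
    integral_const_mul, integral_const_mul, hg1, integral_exp_density hr] at h
  unfold dEnt
  linarith

/-- For `α₁ > 0`, `γ* = ((2+α₁) − √((2+α₁)² − 4))/2 ∈ (0,1)` together with
the exponential density `g*(y) = ((1−γ*)/α₁) exp(−(1−γ*)y/α₁)` maximizes the entropy
`−γ log γ − (1−γ) log(1−γ) + (1−γ)H(g)` among all semi-continuous distributions whose
first moment satisfies `(1−γ)·∫₀^∞ y g(y) dy = α₁`. -/
theorem stmt_6 (α₁ : ℝ) (hα : 0 < α₁) :
    gammaStar α₁ ∈ Set.Ioo (0 : ℝ) 1 ∧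
    ∀ γ ∈ Set.Ioo (0 : ℝ) 1, ∀ g : ℝ → ℝ,
      Measurable g → (∀ y ∈ Set.Ioi (0 : ℝ), 0 ≤ g y) →
      IntegrableOn g (Set.Ioi (0 : ℝ)) → (∫ y in Set.Ioi (0 : ℝ), g y) = 1 →
      IntegrableOn (fun y => g y * Real.log (g y)) (Set.Ioi (0 : ℝ)) →
      IntegrableOn (fun y => y * g y) (Set.Ioi (0 : ℝ)) →
      (1 - γ) * (∫ y in Set.Ioi (0 : ℝ), y * g y) = α₁ →
      -γ * Real.log γ - (1 - γ) * Real.log (1 - γ) + (1 - γ) * dEnt g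
        ≤ -(gammaStar α₁) * Real.log (gammaStar α₁)
          - (1 - gammaStar α₁) * Real.log (1 - gammaStar α₁)
          + (1 - gammaStar α₁) * dEnt (gStar α₁) := by
  refine ⟨gammaStar_mem_Ioo hα, ?_⟩
  intro γ ⟨hγ0, hγ1⟩ g _ hg0 hg hg1 hglog hgy hmean
  obtain ⟨hs0, hs1⟩ := gammaStar_mem_Ioo hα
  have hsq := one_sub_gammaStar_sq hα
  have hstar : gStar α₁ = fun y => (1 - gammaStar α₁) / α₁ *
      Real.exp (-((1 - gammaStar α₁) / α₁) * y) := by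
    funext y
    unfold gStar
    congr 2
    ring
  rw [hstar]
  generalize gammaStar α₁ = s at *
  have hs1' : 0 < 1 - s := sub_pos.2 hs1
  have hr : 0 < (1 - s) / α₁ := div_pos hs1' hα
  have hrα : (1 - s) / α₁ * α₁ = 1 - s := div_mul_cancel₀ _ hα.ne'
  have hlog : Real.log (1 - s) + Real.log ((1 - s) / α₁) = Real.log s := by
    rw [← Real.log_mul hs1'.ne' hr.ne']
    congr 1
    field_simp
    linarith
  rw [dEnt_exp_density hr]
  have hG := mul_le_mul_of_nonneg_left
    (dEnt_le_mul_integral_sub_log hr hg0 hg hg1 hglog hgy) (sub_pos.2 hγ1).le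
  have h₀ := mul_log_add_sub_le_mul_log hγ0.le hs0
  have h₁ := mul_log_add_sub_le_mul_log (sub_pos.2 hγ1).le hs1'
  calc -γ * Real.log γ - (1 - γ) * Real.log (1 - γ) + (1 - γ) * dEnt g
      ≤ -γ * Real.log s - (1 - γ) * Real.log (1 - s)
        + (1 - γ) * ((1 - s) / α₁ * (∫ y in Set.Ioi (0 : ℝ), y * g y)
          - Real.log ((1 - s) / α₁)) := by linarith
    _ = -s * Real.log s - (1 - s) * Real.log (1 - s)
        + (1 - s) * (1 - Real.log ((1 - s) / α₁)) := by
      linear_combination (1 - s) / α₁ * hmean + hrα + (γ - s) * hlog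
end

section
/- Let λ₁ > 0 and λ₂ < 1. Set a = 1−λ₂, b = 1/λ₁, let g*(y) = y^{a−1} e^{−y/b}/(Γ(a) b^a) be the gamma density with shape a and scale b, let γ* = λ₁^{1−λ₂}/(λ₁^{1−λ₂} + Γ(1−λ₂)) ∈ (0,1), and set α₁ = (1−γ*)·(1−λ₂)/λ₁ and α₂ = (1−γ*)·(Γ′(1−λ₂)/Γ(1−λ₂) − log λ₁). Then for every γ ∈ (0,1) and every probability density function g on (0,∞) with finite differential entropy satisfying both (1−γ)·∫₀^∞ y·g(y) dy = α₁ and (1−γ)·∫₀^∞ log(y)·g(y) dy = α₂, one has −γ log γ − (1−γ) log(1−γ) + (1−γ)H(g) ≤ −γ* log γ* − (1−γ*) log(1−γ*) + (1−γ*)H(g*), where H(g) = −∫₀^∞ g(y) log g(y) dy. That is, the semi-continuous gamma distribution with parameters (γ*, g*) maximizes entropy subject to the constraints E(Y) = α₁ and E(1_{Y>0} log Y) = α₂. -/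
open MeasureTheory

/-- The point mass at zero of the maximum-entropy semi-continuous gamma distribution. -/
noncomputable def gammaStarG (l₁ l₂ : ℝ) : ℝ :=
  l₁ ^ (1 - l₂) / (l₁ ^ (1 - l₂) + Real.Gamma (1 - l₂))

/-- The gamma density with shape `a = 1−λ₂` and scale `b = 1/λ₁`. -/
noncomputable def gStarG (l₁ l₂ : ℝ) (y : ℝ) : ℝ :=
  y ^ ((1 - l₂) - 1) * Real.exp (-y / (1 / l₁))
    / (Real.Gamma (1 - l₂) * (1 / l₁) ^ (1 - l₂))

open Real Set Filter Asymptotics Topology in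
theorem integrableOn_log_and_deriv_Gamma {a : ℝ} (ha : 0 < a) :
    IntegrableOn (fun t : ℝ => t ^ (a - 1) * (log t * exp (-t))) (Ioi 0) ∧
      deriv Gamma a = ∫ t in Ioi (0 : ℝ), t ^ (a - 1) * (log t * exp (-t)) := by
  have hre : 0 < (a : ℂ).re := by simpa using ha
  have hEq : EqOn (fun t : ℝ => (t : ℂ) ^ ((a : ℂ) - 1) • (log t • ((exp (-t) : ℝ) : ℂ)))
      (fun t : ℝ => ((t ^ (a - 1) * (log t * exp (-t)) : ℝ) : ℂ)) (Ioi 0) := by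
    intro t ht
    simp only [smul_eq_mul, Complex.real_smul, Complex.ofReal_mul,
      Complex.ofReal_cpow (le_of_lt ht), Complex.ofReal_sub, Complex.ofReal_one]
  have hM : MellinConvergent (fun t : ℝ => log t • ((exp (-t) : ℝ) : ℂ)) (a : ℂ) := by
    refine (mellin_hasDerivAt_of_isBigO_rpow (E := ℂ) ?_ ?_ (lt_add_one _) ?_ hre).1
    · refine (Continuous.continuousOn ?_).locallyIntegrableOn measurableSet_Ioi
      exact Complex.continuous_ofReal.comp (continuous_exp.comp continuous_neg)
    · rw [← isBigO_norm_left]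
      simp_rw [Complex.norm_real, isBigO_norm_left]
      simpa only [neg_one_mul] using (isLittleO_exp_neg_mul_rpow_atTop zero_lt_one _).isBigO
    · simp_rw [neg_zero, rpow_zero]
      refine isBigO_const_of_tendsto (?_ : Tendsto _ _ (𝓝 (1 : ℂ))) one_ne_zero
      rw [(by simp : (1 : ℂ) = Real.exp (-0))]
      exact (Complex.continuous_ofReal.comp
        (continuous_exp.comp continuous_neg)).continuousWithinAt
  constructor
  · have h : IntegrableOn (fun t : ℝ => ((t ^ (a - 1) * (log t * exp (-t)) : ℝ) : ℂ)) (Ioi 0) :=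
      IntegrableOn.congr_fun hM hEq measurableSet_Ioi
    exact Integrable.re h
  · have hG : (fun s => Complex.Gamma s) =ᶠ[𝓝 (a : ℂ)] Complex.GammaIntegral := by
      filter_upwards [(isOpen_lt continuous_const Complex.continuous_re).mem_nhds hre] with s hs
      exact Complex.Gamma_eq_integral hs
    have hd := ((Complex.hasDerivAt_GammaIntegral hre).congr_of_eventuallyEq hG).real_of_complex
    refine hd.deriv.trans ?_
    rw [← Complex.ofReal_re (∫ t in Ioi (0 : ℝ), t ^ (a - 1) * (log t * exp (-t))),
      ← integral_complex_ofReal, ← setIntegral_congr_fun measurableSet_Ioi hEq]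
    simp

open Real Set in
theorem integrableOn_rpow_mul_exp_neg_mul {a l : ℝ} (ha : 0 < a) (hl : 0 < l) :
    IntegrableOn (fun y : ℝ => y ^ (a - 1) * exp (-(l * y))) (Ioi 0) := by
  simpa using integrableOn_rpow_mul_exp_neg_mul_rpow (by linarith : -1 < a - 1) one_pos hl

open Real Set in
theorem id_moment_rpow_mul_exp {a l : ℝ} (ha : 0 < a) (hl : 0 < l) :
    IntegrableOn (fun y : ℝ => y * (y ^ (a - 1) * exp (-(l * y)))) (Ioi 0) ∧
      ∫ y in Ioi (0 : ℝ), y * (y ^ (a - 1) * exp (-(l * y)))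
        = a / l * ((1 / l) ^ a * Gamma a) := by
  have hEq : EqOn (fun y : ℝ => y ^ (a + 1 - 1) * exp (-(l * y)))
      (fun y : ℝ => y * (y ^ (a - 1) * exp (-(l * y)))) (Ioi 0) := by
    intro y hy
    have : y ^ a = y * y ^ (a - 1) := by
      rw [← rpow_one_add' (le_of_lt hy) (by simpa using ha.ne')]
      ring_nf
    simp only [add_sub_cancel_right, this, mul_assoc]
  refine ⟨(integrableOn_rpow_mul_exp_neg_mul (by linarith) hl).congr_fun hEq measurableSet_Ioi, ?_⟩
  rw [← setIntegral_congr_fun measurableSet_Ioi hEq,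
    integral_rpow_mul_exp_neg_mul_Ioi (by linarith) hl, Gamma_add_one ha.ne',
    rpow_add_one (by positivity)]
  ring

open Real Set in
theorem log_moment_rpow_mul_exp {a l : ℝ} (ha : 0 < a) (hl : 0 < l) :
    IntegrableOn (fun y : ℝ => log y * (y ^ (a - 1) * exp (-(l * y)))) (Ioi 0) ∧
      ∫ y in Ioi (0 : ℝ), log y * (y ^ (a - 1) * exp (-(l * y)))
        = (1 / l) ^ a * (deriv Gamma a - log l * Gamma a) := by
  obtain ⟨hI, hD⟩ := integrableOn_log_and_deriv_Gamma ha
  set F : ℝ → ℝ := fun t => t ^ (a - 1) * (log t * exp (-t)) with hF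
  have hEq : EqOn (fun y : ℝ => (l ^ (a - 1))⁻¹ * F (l * y)
        - log l * (y ^ (a - 1) * exp (-(l * y))))
      (fun y : ℝ => log y * (y ^ (a - 1) * exp (-(l * y)))) (Ioi 0) := by
    intro y hy
    have hy' : (0 : ℝ) < y := hy
    have hp : l ^ (a - 1) ≠ 0 := (rpow_pos_of_pos hl _).ne'
    simp only [hF, mul_rpow hl.le hy'.le, log_mul hl.ne' hy'.ne']
    field_simp
    ring
  have hIl : IntegrableOn (fun y => F (l * y)) (Ioi 0) := by
    rw [integrableOn_Ioi_comp_mul_left_iff F 0 hl, mul_zero]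
    exact hI
  have hw := integrableOn_rpow_mul_exp_neg_mul ha hl
  have hI₁ : IntegrableOn (fun y => (l ^ (a - 1))⁻¹ * F (l * y)) (Ioi 0) := hIl.const_mul _
  have hI₂ : IntegrableOn (fun y => log l * (y ^ (a - 1) * exp (-(l * y)))) (Ioi 0) :=
    hw.const_mul _
  refine ⟨IntegrableOn.congr_fun (hI₁.sub hI₂) hEq measurableSet_Ioi, ?_⟩
  rw [← setIntegral_congr_fun measurableSet_Ioi hEq, integral_sub hI₁ hI₂, integral_const_mul,
    integral_const_mul, integral_rpow_mul_exp_neg_mul_Ioi ha hl,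
    integral_comp_mul_left_Ioi F 0 hl, mul_zero, ← hD, smul_eq_mul, ← mul_assoc, ← mul_inv,
    ← rpow_add_one hl.ne', sub_add_cancel, one_div, inv_rpow hl.le]
  ring

theorem mul_log_add_sub_le_mul_log_s16 {u v : ℝ} (hu : 0 ≤ u) (hv : 0 < v) :
    u * Real.log v + u - v ≤ u * Real.log u := by
  rcases hu.eq_or_lt with rfl | hu
  · simpa using hv.le
  · have h := mul_le_mul_of_nonneg_left (Real.log_le_sub_one_of_pos (div_pos hv hu)) hu.le
    rw [Real.log_div hv.ne' hu.ne', mul_sub, mul_sub, mul_div_cancel₀ _ hu.ne'] at h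
    linarith

theorem gStarG_eq (l₁ l₂ y : ℝ) (h1 : 0 < l₁) :
    gStarG l₁ l₂ y = l₁ ^ (1 - l₂) / Real.Gamma (1 - l₂)
      * (y ^ (1 - l₂ - 1) * Real.exp (-(l₁ * y))) := by
  rw [gStarG, one_div, Real.inv_rpow h1.le, div_inv_eq_mul, neg_mul, mul_comm y l₁]
  field_simp

theorem dEnt_gStarG (l₁ l₂ : ℝ) (h1 : 0 < l₁) (h2 : l₂ < 1) :
    dEnt (gStarG l₁ l₂) = -(Real.log (l₁ ^ (1 - l₂) / Real.Gamma (1 - l₂))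
      - l₂ * (deriv Real.Gamma (1 - l₂) / Real.Gamma (1 - l₂) - Real.log l₁) - (1 - l₂)) := by
  have ha : 0 < 1 - l₂ := by linarith
  have hG : 0 < Real.Gamma (1 - l₂) := Real.Gamma_pos_of_pos ha
  have hp : 0 < l₁ ^ (1 - l₂) := Real.rpow_pos_of_pos h1 _
  obtain ⟨hi, hiv⟩ := id_moment_rpow_mul_exp ha h1
  obtain ⟨hl, hlv⟩ := log_moment_rpow_mul_exp ha h1
  have hw := integrableOn_rpow_mul_exp_neg_mul ha h1
  have hwv := Real.integral_rpow_mul_exp_neg_mul_Ioi ha h1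
  set c : ℝ := l₁ ^ (1 - l₂) / Real.Gamma (1 - l₂) with hc
  have hcpos : 0 < c := div_pos hp hG
  set w : ℝ → ℝ := fun y => y ^ (1 - l₂ - 1) * Real.exp (-(l₁ * y)) with hwdef
  have hEq : Set.EqOn (fun y => gStarG l₁ l₂ y * Real.log (gStarG l₁ l₂ y))
      (fun y => c * Real.log c * w y + (-(c * l₂)) * (Real.log y * w y)
        + (-(c * l₁)) * (y * w y)) (Set.Ioi 0) := by
    intro y hy
    have hy' : (0 : ℝ) < y := hy
    have hyp : 0 < y ^ (1 - l₂ - 1) := Real.rpow_pos_of_pos hy' _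
    simp only [gStarG_eq l₁ l₂ y h1, hwdef, ← hc]
    rw [Real.log_mul hcpos.ne' (mul_pos hyp (Real.exp_pos _)).ne',
      Real.log_mul hyp.ne' (Real.exp_pos _).ne', Real.log_exp, Real.log_rpow hy']
    ring
  have e₁ : IntegrableOn (fun y => c * Real.log c * w y) (Set.Ioi 0) := hw.const_mul _
  have e₂ : IntegrableOn (fun y => -(c * l₂) * (Real.log y * w y)) (Set.Ioi 0) :=
    hl.const_mul _
  have e₃ : IntegrableOn (fun y => -(c * l₁) * (y * w y)) (Set.Ioi 0) := hi.const_mul _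
  have hsplit := integral_add (e₁.add e₂) e₃
  have hsplit' := integral_add e₁ e₂
  simp only [Pi.add_apply] at hsplit hsplit'
  rw [dEnt, setIntegral_congr_fun measurableSet_Ioi hEq, hsplit, hsplit', integral_const_mul, integral_const_mul, integral_const_mul,
    hwv, hlv, hiv]
  rw [one_div, Real.inv_rpow h1.le]
  generalize Real.log c = L
  rw [hc]
  field_simp
  ring

theorem gammaStarG_mem_Ioo (l₁ l₂ : ℝ) (h1 : 0 < l₁) (h2 : l₂ < 1) :
    gammaStarG l₁ l₂ ∈ Set.Ioo (0 : ℝ) 1 := by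
  have hG : 0 < Real.Gamma (1 - l₂) := Real.Gamma_pos_of_pos (by linarith)
  have hp : 0 < l₁ ^ (1 - l₂) := Real.rpow_pos_of_pos h1 _
  refine ⟨div_pos hp (add_pos hp hG), ?_⟩
  rw [gammaStarG, div_lt_one (add_pos hp hG)]
  linarith

theorem one_sub_gammaStarG_mul (l₁ l₂ : ℝ) (h1 : 0 < l₁) (h2 : l₂ < 1) :
    (1 - gammaStarG l₁ l₂) * (l₁ ^ (1 - l₂) / Real.Gamma (1 - l₂)) = gammaStarG l₁ l₂ := by
  have hG : 0 < Real.Gamma (1 - l₂) := Real.Gamma_pos_of_pos (by linarith)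
  have hp : 0 < l₁ ^ (1 - l₂) := Real.rpow_pos_of_pos h1 _
  rw [gammaStarG]
  field_simp
  ring

/-- For `λ₁ > 0`, `λ₂ < 1`, with `γ* = λ₁^{1−λ₂}/(λ₁^{1−λ₂} + Γ(1−λ₂))`,
`g*` the gamma density with shape `1−λ₂` and scale `1/λ₁`,
`α₁ = (1−γ*)(1−λ₂)/λ₁` and `α₂ = (1−γ*)(ψ(1−λ₂) − log λ₁)`, the pair `(γ*, g*)`
maximizes the semi-continuous entropy among all `(γ, g)` satisfying both moment
constraints. Moreover `γ* ∈ (0,1)`. -/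
theorem stmt_16 (l₁ l₂ : ℝ) (h1 : 0 < l₁) (h2 : l₂ < 1) :
    gammaStarG l₁ l₂ ∈ Set.Ioo (0 : ℝ) 1 ∧
    ∀ γ ∈ Set.Ioo (0 : ℝ) 1, ∀ g : ℝ → ℝ,
      Measurable g → (∀ y ∈ Set.Ioi (0 : ℝ), 0 ≤ g y) →
      IntegrableOn g (Set.Ioi (0 : ℝ)) → (∫ y in Set.Ioi (0 : ℝ), g y) = 1 →
      IntegrableOn (fun y => g y * Real.log (g y)) (Set.Ioi (0 : ℝ)) →
      IntegrableOn (fun y => y * g y) (Set.Ioi (0 : ℝ)) →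
      IntegrableOn (fun y => Real.log y * g y) (Set.Ioi (0 : ℝ)) →
      (1 - γ) * (∫ y in Set.Ioi (0 : ℝ), y * g y)
          = (1 - gammaStarG l₁ l₂) * (1 - l₂) / l₁ →
      (1 - γ) * (∫ y in Set.Ioi (0 : ℝ), Real.log y * g y)
          = (1 - gammaStarG l₁ l₂)
            * (deriv Real.Gamma (1 - l₂) / Real.Gamma (1 - l₂) - Real.log l₁) →
      -γ * Real.log γ - (1 - γ) * Real.log (1 - γ) + (1 - γ) * dEnt g
        ≤ -(gammaStarG l₁ l₂) * Real.log (gammaStarG l₁ l₂)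
          - (1 - gammaStarG l₁ l₂) * Real.log (1 - gammaStarG l₁ l₂)
          + (1 - gammaStarG l₁ l₂) * dEnt (gStarG l₁ l₂) := by
  have hs := gammaStarG_mem_Ioo l₁ l₂ h1 h2
  refine ⟨hs, ?_⟩
  intro γ hγ g _ hg0 hgi hg1 hgl hgid hglog hα₁ hα₂
  have ha : 0 < 1 - l₂ := by linarith
  have hc : 0 < l₁ ^ (1 - l₂) / Real.Gamma (1 - l₂) :=
    div_pos (Real.rpow_pos_of_pos h1 _) (Real.Gamma_pos_of_pos ha)
  have hsc := one_sub_gammaStarG_mul l₁ l₂ h1 h2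
  have hw := integrableOn_rpow_mul_exp_neg_mul ha h1
  have hwv := Real.integral_rpow_mul_exp_neg_mul_Ioi ha h1
  rw [dEnt_gStarG l₁ l₂ h1 h2]
  set s := gammaStarG l₁ l₂
  set c : ℝ := l₁ ^ (1 - l₂) / Real.Gamma (1 - l₂) with hcdef
  set ψ := deriv Real.Gamma (1 - l₂) / Real.Gamma (1 - l₂) - Real.log l₁
  obtain ⟨hs0, hs1⟩ := hs
  obtain ⟨hγ0, hγ1⟩ := hγ
  have h1s : 0 < 1 - s := by linarith
  have h1γ : 0 < 1 - γ := by linarith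
  have hlog : Real.log s = Real.log (1 - s) + Real.log c := by
    rw [← Real.log_mul h1s.ne' hc.ne', hsc]
  set w : ℝ → ℝ := fun y => y ^ (1 - l₂ - 1) * Real.exp (-(l₁ * y)) with hwdef
  have hsw : s * ∫ y in Set.Ioi (0 : ℝ), w y = 1 - s := by
    have hG := (Real.Gamma_pos_of_pos ha).ne'
    have hp := (Real.rpow_pos_of_pos h1 (1 - l₂)).ne'
    rw [hwv, one_div, Real.inv_rpow h1.le]
    nth_rewrite 1 [← hsc]
    rw [hcdef]
    field_simp
  have hpt : ∀ y ∈ Set.Ioi (0 : ℝ),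
      (1 - γ) * (Real.log s + 1 - Real.log (1 - γ)) * g y
          + (1 - γ) * (-l₂) * (Real.log y * g y) + (1 - γ) * (-l₁) * (y * g y) + (-s) * w y
        ≤ (1 - γ) * (g y * Real.log (g y)) := by
    intro y hy
    have hy' : (0 : ℝ) < y := hy
    have hyp : 0 < y ^ (1 - l₂ - 1) := Real.rpow_pos_of_pos hy' _
    have hwp : 0 < w y := mul_pos hyp (Real.exp_pos _)
    have hlw : Real.log (w y) = -l₂ * Real.log y - l₁ * y := by
      simp only [hwdef]
      rw [Real.log_mul hyp.ne' (Real.exp_pos _).ne', Real.log_exp, Real.log_rpow hy']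
      ring
    have h := mul_log_add_sub_le_mul_log_s16 (mul_nonneg h1γ.le (hg0 y hy))
      (mul_pos hs0 hwp)
    rw [Real.log_mul hs0.ne' hwp.ne', hlw] at h
    have hgg : (1 - γ) * g y * Real.log ((1 - γ) * g y)
        = (1 - γ) * g y * Real.log (1 - γ) + (1 - γ) * (g y * Real.log (g y)) := by
      rcases (hg0 y hy).eq_or_lt with h0 | h0
      · simp [← h0]
      · rw [Real.log_mul h1γ.ne' h0.ne']
        ring
    rw [hgg] at h
    linarith
  have e₁ : IntegrableOn (fun y => (1 - γ) * (Real.log s + 1 - Real.log (1 - γ)) * g y)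
      (Set.Ioi 0) := hgi.const_mul _
  have e₂ : IntegrableOn (fun y => (1 - γ) * (-l₂) * (Real.log y * g y)) (Set.Ioi 0) :=
    hglog.const_mul _
  have e₃ : IntegrableOn (fun y => (1 - γ) * (-l₁) * (y * g y)) (Set.Ioi 0) := hgid.const_mul _
  have e₄ : IntegrableOn (fun y => (-s) * w y) (Set.Ioi 0) := hw.const_mul _
  have hint := setIntegral_mono_on (((e₁.add e₂).add e₃).add e₄) (hgl.const_mul (1 - γ))
    measurableSet_Ioi hpt
  have hsplit := integral_add ((e₁.add e₂).add e₃) e₄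
  have hsplit' := integral_add (e₁.add e₂) e₃
  have hsplit'' := integral_add e₁ e₂
  simp only [Pi.add_apply] at hint hsplit hsplit' hsplit''
  rw [hsplit, hsplit', hsplit'', integral_const_mul, integral_const_mul, integral_const_mul,
    integral_const_mul, integral_const_mul, hg1] at hint
  have hγs := mul_log_add_sub_le_mul_log_s16 hγ0.le hs0
  have hα₁' : l₁ * ((1 - γ) * ∫ y in Set.Ioi (0 : ℝ), y * g y) = (1 - s) * (1 - l₂) := by
    rw [hα₁]
    field_simp
  have hα₂' := congrArg (fun x => l₂ * x) hα₂
  beta_reduce at hα₂'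
  have hlog' : Real.log c = Real.log s - Real.log (1 - s) := by linarith
  rw [dEnt, hlog']
  linarith
end
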